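/- arXiv:1502.06269 — 3 statements merged into one kernel-verified Lean document; each statement's English description precedes it below -/
import Mathlib

section
/- Let p(s) = 8s^4 - 50s^2 + 75. Then p(s) > 0 for all s in [0, π/2], p'(0) = 0, and for all s in (0, π/2) one has p''(s) + G(s)·p'(s) + p(s) ≤ 0. (Consequently v⁺(r,s) = e^{-|r|} p(s) is a positive supersolution of the operator L_Ω(v) = v_rr + v_ss + G(s) v_s with decay rate δ = 1.) -/
/-- `G(s) = (1/2)·((√(1+sin s) + √(1−sin s))/(√(1+sin s) − √(1−sin s)) + tan s)`. -/
noncomputable def G (s : ℝ) : ℝ :=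
  (1 / 2) * ((Real.sqrt (1 + Real.sin s) + Real.sqrt (1 - Real.sin s)) /
      (Real.sqrt (1 + Real.sin s) - Real.sqrt (1 - Real.sin s)) + Real.tan s)

/-- `p(s) = 8s⁴ − 50s² + 75`. -/
noncomputable def p (s : ℝ) : ℝ := 8 * s ^ 4 - 50 * s ^ 2 + 75

theorem G_eq {s : ℝ} (hs : s ∈ Set.Ioo (0 : ℝ) (Real.pi / 2)) :
    G s = (1 + Real.cos s) / (2 * (Real.sin s * Real.cos s)) := by
  obtain ⟨h0, h1⟩ := hs
  obtain ⟨h, rfl⟩ : ∃ h, s = 2 * h := ⟨s / 2, by ring⟩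
  have ha : 0 < Real.sin h := Real.sin_pos_of_pos_of_lt_pi (by linarith) (by linarith)
  have hb : 0 < Real.cos h := Real.cos_pos_of_mem_Ioo ⟨by linarith, by linarith⟩
  have hc : 0 < Real.cos (2 * h) := Real.cos_pos_of_mem_Ioo ⟨by linarith, by linarith⟩
  have hsq := Real.sin_sq_add_cos_sq h
  have hab : Real.sin h ≤ Real.cos h := by
    rw [Real.cos_two_mul] at hc
    nlinarith
  have h_add : Real.sqrt (1 + Real.sin (2 * h)) = Real.cos h + Real.sin h := by
    rw [Real.sin_two_mul, ← Real.sqrt_sq (add_pos hb ha).le]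
    congr 1
    linear_combination -hsq
  have h_sub : Real.sqrt (1 - Real.sin (2 * h)) = Real.cos h - Real.sin h := by
    rw [Real.sin_two_mul, ← Real.sqrt_sq (sub_nonneg.2 hab)]
    congr 1
    linear_combination -hsq
  have h_ratio : (Real.cos h + Real.sin h + (Real.cos h - Real.sin h)) /
      (Real.cos h + Real.sin h - (Real.cos h - Real.sin h)) = Real.cos h / Real.sin h := by
    rw [div_eq_div_iff (by linarith) ha.ne']
    ring
  rw [G, h_add, h_sub, h_ratio, Real.tan_eq_sin_div_cos, Real.sin_two_mul]
  field_simp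
  rw [Real.cos_two_mul]
  linear_combination (4 * Real.cos h ^ 2) * hsq

theorem Real.cos_le_one_sub_sq_add_pow_four {s : ℝ} (h0 : 0 ≤ s) (h1 : s ^ 2 ≤ 24) :
    Real.cos s ≤ 1 - s ^ 2 / 2 + s ^ 4 / 24 := by
  have hsin := Real.sin_ge_sub_cube (x := s / 2) (by linarith)
  have hnn : 0 ≤ s / 2 - (s / 2) ^ 3 / 6 := by nlinarith
  have hsq := pow_le_pow_left₀ hnn hsin 2
  rw [Real.sin_sq_eq_half_sub, mul_div_cancel₀ s two_ne_zero] at hsq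
  nlinarith [sq_nonneg (s ^ 3)]

theorem deriv_p : deriv p = fun s ↦ 32 * s ^ 3 - 100 * s := by
  funext s
  have h : HasDerivAt p (8 * (4 * s ^ 3) - 50 * (2 * s)) s := by
    have h := (((hasDerivAt_pow 4 s).const_mul 8).fun_sub
      ((hasDerivAt_pow 2 s).const_mul 50)).add_const 75
    exact h.congr_deriv (by norm_num)
  rw [h.deriv]
  ring

theorem deriv_deriv_p (s : ℝ) : deriv (deriv p) s = 96 * s ^ 2 - 100 := by
  have h : HasDerivAt (fun s : ℝ ↦ 32 * s ^ 3 - 100 * s) (32 * (3 * s ^ 2) - 100 * 1) s := by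
    simpa using ((hasDerivAt_pow 3 s).const_mul 32).fun_sub ((hasDerivAt_id s).const_mul 100)
  rw [deriv_p, h.deriv]
  ring

/-- `p` is positive on `[0, π/2]`, `p'(0) = 0`, and
`p''(s) + G(s)·p'(s) + p(s) ≤ 0` on `(0, π/2)`. -/
theorem stmt_0 :
    (∀ s ∈ Set.Icc (0 : ℝ) (Real.pi / 2), 0 < p s) ∧
    deriv p 0 = 0 ∧
    (∀ s ∈ Set.Ioo (0 : ℝ) (Real.pi / 2),
      deriv (deriv p) s + G s * deriv p s + p s ≤ 0) := by
  have h_pi := Real.pi_lt_d2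
  have h_lt : ∀ s : ℝ, 0 ≤ s → s ≤ Real.pi / 2 → s ^ 2 < 5 / 2 := fun s h0 h1 ↦ by nlinarith
  refine ⟨fun s hs ↦ ?_, by simp [deriv_p], fun s hs ↦ ?_⟩
  · have hu := h_lt s hs.1 hs.2
    rw [p]
    nlinarith
  have hu := h_lt s hs.1.le hs.2.le
  have hs0 := hs.1
  have hsin : 0 < Real.sin s := Real.sin_pos_of_pos_of_lt_pi hs.1 (by linarith [hs.2])
  have hc : 0 < Real.cos s := Real.cos_pos_of_mem_Ioo ⟨by linarith [Real.pi_pos], hs.2⟩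
  have h_cos := Real.cos_le_one_sub_sq_add_pow_four hs.1.le (by linarith)
  have hG : (1 + Real.cos s) / (2 * Real.cos s) ≤ G s * s := by
    rw [G_eq hs, div_mul_eq_mul_div, div_le_div_iff₀ (by positivity) (by positivity)]
    have := mul_le_mul_of_nonneg_left (Real.sin_le hs.1.le)
      (show 0 ≤ (1 + Real.cos s) * (2 * Real.cos s) by positivity)
    linarith
  have h_poly : (8 * s ^ 4 + 62 * s ^ 2 - 75) * Real.cos s ≤ 50 - 16 * s ^ 2 := by
    rw [show s ^ 4 = (s ^ 2) ^ 2 by ring] at *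
    have hu0 := sq_nonneg s
    generalize s ^ 2 = u at *
    rcases le_total (8 * u ^ 2 + 62 * u - 75) 0 with hK | hK
    · nlinarith
    · refine (mul_le_mul_of_nonneg_left h_cos hK).trans ?_
      nlinarith [mul_nonneg hu0 (sub_nonneg.2 hu.le), sq_nonneg (u - 2), sq_nonneg (u ^ 2 - 2 * u),
        mul_nonneg hu0 (sq_nonneg (u - 2)), mul_nonneg (sub_nonneg.2 hu.le) (sq_nonneg (u - 2))]
  have h_main : 8 * s ^ 4 + 46 * s ^ 2 - 25 ≤
      4 * (25 - 8 * s ^ 2) * ((1 + Real.cos s) / (2 * Real.cos s)) := by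
    rw [mul_div_assoc', le_div_iff₀ (by positivity)]
    linarith
  have h_mul := mul_le_mul_of_nonneg_left hG (show 0 ≤ 4 * (25 - 8 * s ^ 2) by linarith)
  rw [deriv_deriv_p, deriv_p, p]
  linarith
end

section
/- For every s in the open interval (√2/2, π/2), one has (8s^4 + 46s^2 − 25) + (16s^3 − 50s) + (8s^3 − 25s)/cos(s) ≤ 0. -/
/-- For every `s ∈ (√2/2, π/2)`,
`(8s⁴ + 46s² − 25) + (16s³ − 50s) + (8s³ − 25s)/cos s ≤ 0`. -/
theorem stmt_4 :
    ∀ s ∈ Set.Ioo (Real.sqrt 2 / 2) (Real.pi / 2),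
      (8 * s ^ 4 + 46 * s ^ 2 - 25) + (16 * s ^ 3 - 50 * s) +
        (8 * s ^ 3 - 25 * s) / Real.cos s ≤ 0 := by
  rintro s ⟨hs, hs'⟩
  have hs0 : 0 < s := lt_trans (by positivity) hs
  have hpi : s < 1.5708 := by linarith [Real.pi_lt_d4]
  have hcos : 0 < Real.cos s := Real.cos_pos_of_mem_Ioo ⟨by linarith, hs'⟩
  have hcos_le : Real.cos s ≤ 1.5708 - s := by
    rw [← Real.sin_pi_div_two_sub]
    linarith [Real.sin_le (x := Real.pi / 2 - s) (by linarith), Real.pi_lt_d4]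
  have hq : 8 * s ^ 3 - 25 * s ≤ 0 := by nlinarith [mul_pos hs0 hs0]
  rcases le_total ((8 * s ^ 4 + 46 * s ^ 2 - 25) + (16 * s ^ 3 - 50 * s)) 0 with hp | hp
  · linarith [div_nonpos_of_nonpos_of_nonneg hq hcos.le]
  · have hs1 : 1 ≤ s := by
      by_contra! h
      nlinarith [mul_pos hs0 (sub_pos.2 h), mul_pos (mul_pos hs0 hs0) (sub_pos.2 h),
        mul_pos (mul_pos (mul_pos hs0 hs0) hs0) (sub_pos.2 h)]
    have key : ((8 * s ^ 4 + 46 * s ^ 2 - 25) + (16 * s ^ 3 - 50 * s)) * (1.5708 - s) +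
        (8 * s ^ 3 - 25 * s) ≤ 0 := by
      nlinarith [mul_nonneg (sub_nonneg.2 hs1) (sq_nonneg (s - 1.39)),
        mul_nonneg (sub_nonneg.2 hs1) (sq_nonneg (s * (s - 1.39))), sq_nonneg (s - 1.39),
        sq_nonneg (s * (s - 1.39)), mul_nonneg hs0.le (sq_nonneg (s - 1.39))]
    have := mul_le_mul_of_nonneg_left hcos_le hp
    rw [add_div' _ _ _ hcos.ne']
    exact div_nonpos_of_nonpos_of_nonneg (by linarith) hcos.le
end

section
/- The function f(x, y) = sinh( (1/2)·arcsinh( 2x / (1 − x^2 − y^2) ) ) is Lebesgue integrable over the half-disk H = { (x, y) ∈ ℝ^2 : x^2 + y^2 < 1 and x > 0 }, i.e. ∫_H f(x,y) dx dy < ∞ (and f ≥ 0 on H). -/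
open MeasureTheory

/-- The half-disk `H = {(x, y) ∈ ℝ² : x² + y² < 1, x > 0}`. -/
def H : Set (ℝ × ℝ) := {p | p.1 ^ 2 + p.2 ^ 2 < 1 ∧ 0 < p.1}

/-- `f(x, y) = sinh((1/2)·arcsinh(2x/(1 − x² − y²)))`. -/
noncomputable def f (p : ℝ × ℝ) : ℝ :=
  Real.sinh ((1 / 2) * Real.arsinh (2 * p.1 / (1 - p.1 ^ 2 - p.2 ^ 2)))

theorem sinh_half_arsinh_sq_le {z : ℝ} (hz : 0 ≤ z) :
    Real.sinh ((1 / 2) * Real.arsinh z) ^ 2 ≤ z / 2 := by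
  have hs : 0 ≤ Real.sinh ((1 / 2) * Real.arsinh z) :=
    Real.sinh_nonneg_iff.2 (mul_nonneg (by norm_num) (Real.arsinh_nonneg_iff.2 hz))
  have hd : z = 2 * Real.sinh ((1 / 2) * Real.arsinh z) *
      Real.cosh ((1 / 2) * Real.arsinh z) := by
    rw [← Real.sinh_two_mul, ← mul_assoc]
    norm_num
  have hc := Real.sinh_lt_cosh ((1 / 2) * Real.arsinh z)
  nlinarith

theorem f_nonneg {p : ℝ × ℝ} (hp : p ∈ H) : 0 ≤ f p := by
  obtain ⟨h1, h2⟩ := hp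
  exact Real.sinh_nonneg_iff.2 (mul_nonneg (by norm_num) (Real.arsinh_nonneg_iff.2
    (div_nonneg (by linarith) (by linarith))))

theorem sqrt_sub_mem_Ioo {p : ℝ × ℝ} (hp : p ∈ H) :
    √(1 - p.2 ^ 2) - p.1 ∈ Set.Ioo 0 1 := by
  obtain ⟨h1, h2⟩ := hp
  have ha : p.1 < √(1 - p.2 ^ 2) := Real.lt_sqrt_of_sq_lt (by linarith)
  have hb : √(1 - p.2 ^ 2) ≤ 1 := Real.sqrt_le_one.2 (by nlinarith)
  constructor <;> linarith

theorem f_le_rpow {p : ℝ × ℝ} (hp : p ∈ H) :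
    f p ≤ (√(1 - p.2 ^ 2) - p.1) ^ (-(1 / 2) : ℝ) := by
  have hu := (sqrt_sub_mem_Ioo hp).1
  obtain ⟨h1, h2⟩ := hp
  have hsq : √(1 - p.2 ^ 2) ^ 2 = 1 - p.2 ^ 2 := Real.sq_sqrt (by nlinarith)
  have hz : 0 ≤ 2 * p.1 / (1 - p.1 ^ 2 - p.2 ^ 2) := div_nonneg (by linarith) (by linarith)
  rw [Real.rpow_neg hu.le, ← Real.sqrt_eq_rpow, ← Real.sqrt_inv]
  refine Real.le_sqrt_of_sq_le ((sinh_half_arsinh_sq_le hz).trans ?_)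
  have hfac : 1 - p.1 ^ 2 - p.2 ^ 2 = (√(1 - p.2 ^ 2) - p.1) * (√(1 - p.2 ^ 2) + p.1) := by
    linear_combination -hsq
  rw [hfac, div_div, inv_eq_one_div,
    div_le_div_iff₀ (by nlinarith) hu]
  nlinarith [mul_nonneg hu.le (Real.sqrt_nonneg (1 - p.2 ^ 2))]

theorem measurable_f : Measurable f := by
  unfold f
  have : Measurable Real.arsinh := Real.continuous_arsinh.measurable
  fun_prop

theorem lintegral_Ioo_rpow_neg_half_lt_top :
    ∫⁻ u, (Set.Ioo (0 : ℝ) 1).indicator (fun u ↦ ENNReal.ofReal (u ^ (-(1 / 2) : ℝ))) u < ⊤ := by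
  rw [lintegral_indicator measurableSet_Ioo]
  have h : IntegrableOn (fun u : ℝ ↦ u ^ (-(1 / 2) : ℝ)) (Set.Ioo 0 1) :=
    (intervalIntegral.integrableOn_Ioo_rpow_iff one_pos).2 (by norm_num)
  exact h.lintegral_lt_top

/-- `f` is nonnegative on `H` and Lebesgue integrable over `H`. -/
theorem stmt_16 :
    IntegrableOn f H volume ∧ ∀ p ∈ H, 0 ≤ f p := by
  refine ⟨⟨measurable_f.aestronglyMeasurable, ?_⟩, fun p hp ↦ f_nonneg hp⟩
  set h : ℝ → ENNReal :=
    (Set.Ioo (0 : ℝ) 1).indicator (fun u ↦ ENNReal.ofReal (u ^ (-(1 / 2) : ℝ))) with hh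
  have hm : Measurable h := Measurable.indicator (by fun_prop) measurableSet_Ioo
  set G : ℝ × ℝ → ENNReal := fun p ↦
    (Set.Ioo (-1 : ℝ) 1).indicator 1 p.2 * h (√(1 - p.2 ^ 2) - p.1) with hG
  have hGm : Measurable G := by
    have : Measurable ((Set.Ioo (-1 : ℝ) 1).indicator (1 : ℝ → ENNReal)) :=
      measurable_one.indicator measurableSet_Ioo
    fun_prop
  have hfG : ∀ p ∈ H, ‖f p‖ₑ ≤ G p := by
    intro p hp
    have hy : p.2 ∈ Set.Ioo (-1 : ℝ) 1 := by
      obtain ⟨h1, h2⟩ := hp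
      constructor <;> nlinarith
    rw [Real.enorm_of_nonneg (f_nonneg hp), hG]
    simp only [hh, Set.indicator_of_mem hy, Set.indicator_of_mem (sqrt_sub_mem_Ioo hp),
      Pi.one_apply, one_mul]
    exact ENNReal.ofReal_le_ofReal (f_le_rpow hp)
  calc ∫⁻ p in H, ‖f p‖ₑ ≤ ∫⁻ p in H, G p := setLIntegral_mono hGm hfG
    _ ≤ ∫⁻ p, G p := setLIntegral_le_lintegral _ _
    _ = ∫⁻ y, ∫⁻ x, G (x, y) := by
      rw [Measure.volume_eq_prod, lintegral_prod_symm' _ hGm]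
    _ = ∫⁻ y, (Set.Ioo (-1 : ℝ) 1).indicator 1 y * ∫⁻ u, h u := by
      refine lintegral_congr fun y ↦ ?_
      simp only [hG]
      rw [lintegral_const_mul _ (by fun_prop), lintegral_sub_left_eq_self]
    _ = volume (Set.Ioo (-1 : ℝ) 1) * ∫⁻ u, h u := by
      rw [lintegral_mul_const _ (measurable_one.indicator measurableSet_Ioo),
        lintegral_indicator_one measurableSet_Ioo]
    _ < ⊤ := ENNReal.mul_lt_top measure_Ioo_lt_top lintegral_Ioo_rpow_neg_half_lt_top
end
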